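/- For all networks N_X = (X, r_X) and N_Y = (Y, r_Y), the partial embedding distance is bounded above by the interior partial embedding distance: d_PE(N_X, N_Y) ≤ d_PES(N_X, N_Y). -/

import Mathlib

open scoped BigOperators

/-- Network difference of a map `φ : X → Y` between networks `(X, rX)` and `(Y, rY)`:
`Δ_{X,Y}(φ) = max_{x,x'} |rX x x' - rY (φ x) (φ x')|`. -/
noncomputable def netDiff {X Y : Type*} (rX : X → X → ℝ)
    (rY : Y → Y → ℝ) (φ : X → Y) : ℝ :=
  ⨆ x : X, ⨆ x' : X, |rX x x' - rY (φ x) (φ x')|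

/-- Partial embedding distance `d_PE(N_X, N_Y) = min_{φ : X → Y} Δ_{X,Y}(φ)`. -/
noncomputable def dPE {X Y : Type*} (rX : X → X → ℝ) (rY : Y → Y → ℝ) : ℝ :=
  ⨅ φ : X → Y, netDiff rX rY φ

/-- Embedding distance `d_E(N_X, N_Y) = max {d_PE(N_X, N_Y), d_PE(N_Y, N_X)}`. -/
noncomputable def dE {X Y : Type*} (rX : X → X → ℝ) (rY : Y → Y → ℝ) : ℝ :=
  max (dPE rX rY) (dPE rY rX)

/-- The vertex `e_i` of the standard simplex `S_X ⊆ ℝ^X`. -/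
def vertex {X : Type*} [DecidableEq X] (i : X) : X → ℝ :=
  fun j => if j = i then 1 else 0

/-- A flow from `p` to `m`: an antisymmetric `W : X × X → ℝ` with
`m i = p i + ∑ j, W j i` for every `i`. -/
def IsFlow {X : Type*} [Fintype X] (p m : X → ℝ) (W : X → X → ℝ) : Prop :=
  (∀ i j, W i j = - W j i) ∧ ∀ i, m i = p i + ∑ j, W j i

/-- The size `∑_{i<j} |W(i,j)|` of a flow. -/
noncomputable def flowSize {X : Type*} [Fintype X] [LinearOrder X] (W : X → X → ℝ) : ℝ :=
  ∑ i, ∑ j, if i < j then |W i j| else 0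

/-- The weighted cost `∑_{i<j} |W(i,j)| * r i j` of a flow. -/
noncomputable def flowCost {X : Type*} [Fintype X] [LinearOrder X]
    (r : X → X → ℝ) (W : X → X → ℝ) : ℝ :=
  ∑ i, ∑ j, if i < j then |W i j| * r i j else 0

/-- The minimal transformation cost `c_X(p, m)`: the infimum of the sizes of
all flows from `p` to `m`. -/
noncomputable def minCost {X : Type*} [Fintype X] [LinearOrder X] (p m : X → ℝ) : ℝ :=
  sInf { s : ℝ | ∃ W : X → X → ℝ, IsFlow p m W ∧ flowSize W = s }

/-- The induced dissimilarity `s_X(p, m)`: the infimum of the weighted costs of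
flows from `p` to `m` whose size equals `c_X(p, m)`. -/
noncomputable def sDis {X : Type*} [Fintype X] [LinearOrder X]
    (r : X → X → ℝ) (p m : X → ℝ) : ℝ :=
  sInf { t : ℝ | ∃ W : X → X → ℝ,
    IsFlow p m W ∧ flowSize W = minCost p m ∧ flowCost r W = t }

/-- The interior partial embedding distance `d_PES(N_X, N_Y)`: infimum over maps
`φ : S_X → S_Y` sending vertices of `S_X` to vertices of `S_Y`, of
`sup_{u, u' ∈ S_X} |s_X(u,u') - s_Y(φ u, φ u')|`. -/
noncomputable def dPES {X Y : Type*} [Fintype X] [LinearOrder X] [Fintype Y] [LinearOrder Y]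
    (rX : X → X → ℝ) (rY : Y → Y → ℝ) : ℝ :=
  sInf { t : ℝ | ∃ φ : (X → ℝ) → (Y → ℝ),
    (∀ u ∈ stdSimplex ℝ X, φ u ∈ stdSimplex ℝ Y) ∧
    (∀ x : X, ∃ y : Y, φ (vertex x) = vertex y) ∧
    t = sSup { d : ℝ | ∃ u ∈ stdSimplex ℝ X, ∃ u' ∈ stdSimplex ℝ X,
      d = |sDis rX u u' - sDis rY (φ u) (φ u')| } }

theorem sum_sum_ite_lt_eq_half {X : Type*} [Fintype X] [LinearOrder X] (f : X → X → ℝ)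
    (hs : ∀ a b, f a b = f b a) (h0 : ∀ a, f a a = 0) :
    (∑ a, ∑ b, if a < b then f a b else 0) = (∑ a, ∑ b, f a b) / 2 := by
  have h1 : (∑ a, ∑ b, if a < b then f a b else 0) = ∑ a, ∑ b, if b < a then f a b else 0 := by
    rw [Finset.sum_comm]
    refine Finset.sum_congr rfl fun a _ => Finset.sum_congr rfl fun b _ => ?_
    rw [hs]
  have h2 : (∑ a, ∑ b, f a b) = (∑ a, ∑ b, if a < b then f a b else 0) +
      ∑ a, ∑ b, if b < a then f a b else 0 := by
    simp only [← Finset.sum_add_distrib]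
    refine Finset.sum_congr rfl fun a _ => Finset.sum_congr rfl fun b _ => ?_
    rcases lt_trichotomy a b with h | h | h
    · simp [h, h.not_gt]
    · simp [h, h0]
    · simp [h, h.not_gt]
  linarith

theorem le_sum_sum {X : Type*} [Fintype X] {r : X → X → ℝ} (hr : ∀ a b, 0 ≤ r a b) (a b : X) :
    r a b ≤ ∑ a, ∑ b, r a b :=
  (Finset.single_le_sum (f := fun b => r a b) (fun b _ => hr a b) (Finset.mem_univ b)).trans
    (Finset.single_le_sum (f := fun a => ∑ b, r a b)
      (fun a _ => Finset.sum_nonneg fun b _ => hr a b) (Finset.mem_univ a))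

section Flow

variable {X : Type*} [Fintype X] {p m : X → ℝ} {W : X → X → ℝ}

theorem IsFlow.self_eq_zero (h : IsFlow p m W) (a : X) : W a a = 0 := by
  linarith [h.1 a a]

theorem IsFlow.abs_symm (h : IsFlow p m W) (a b : X) : |W a b| = |W b a| := by
  rw [h.1 a b, abs_neg]

theorem IsFlow.abs_sub_le_sum_row (h : IsFlow p m W) (a : X) : |m a - p a| ≤ ∑ b, |W a b| := by
  rw [h.2 a, add_sub_cancel_left]
  refine (Finset.abs_sum_le_sum_abs _ _).trans (Finset.sum_le_sum fun b _ => ?_)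
  rw [h.abs_symm]

theorem IsFlow.abs_sub_le_sum_col (h : IsFlow p m W) (a : X) : |m a - p a| ≤ ∑ b, |W b a| := by
  rw [h.2 a, add_sub_cancel_left]
  exact Finset.abs_sum_le_sum_abs _ _

/-- The flow transporting `p` to `m` proportionally. -/
def productFlow (p m : X → ℝ) (a b : X) : ℝ := p a * m b - p b * m a

theorem isFlow_productFlow (hp : ∑ a, p a = 1) (hm : ∑ a, m a = 1) :
    IsFlow p m (productFlow p m) := by
  refine ⟨fun a b => by simp only [productFlow]; ring, fun a => ?_⟩
  simp only [productFlow, Finset.sum_sub_distrib, ← Finset.sum_mul, ← Finset.mul_sum, hp, hm]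
  ring

theorem abs_productFlow_vertex {X : Type*} [DecidableEq X] {i j : X} (hij : i ≠ j) (a b : X) :
    |productFlow (vertex i) (vertex j) a b| =
      (if a = i then if b = j then 1 else 0 else 0) +
        (if a = j then if b = i then 1 else 0 else 0) := by
  simp only [productFlow, vertex]
  split_ifs <;> simp_all

variable [LinearOrder X]

theorem IsFlow.flowSize_eq_half (h : IsFlow p m W) :
    flowSize W = (∑ a, ∑ b, |W a b|) / 2 :=
  sum_sum_ite_lt_eq_half _ h.abs_symm fun a => by simp [h.self_eq_zero]

theorem IsFlow.flowCost_eq_half (h : IsFlow p m W) {r : X → X → ℝ} (hr : ∀ a b, r a b = r b a) :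
    flowCost r W = (∑ a, ∑ b, |W a b| * r a b) / 2 :=
  sum_sum_ite_lt_eq_half (fun a b => |W a b| * r a b)
    (fun a b => by rw [h.abs_symm, hr]) fun a => by simp [h.self_eq_zero]

theorem flowSize_nonneg (W : X → X → ℝ) : 0 ≤ flowSize W :=
  Finset.sum_nonneg fun _ _ => Finset.sum_nonneg fun _ _ => by split_ifs <;> positivity

theorem flowCost_nonneg {r : X → X → ℝ} (hr : ∀ a b, 0 ≤ r a b) (W : X → X → ℝ) :
    0 ≤ flowCost r W :=
  Finset.sum_nonneg fun a _ => Finset.sum_nonneg fun b _ => by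
    have := hr a b
    split_ifs <;> positivity

theorem flowCost_le {r : X → X → ℝ} (hr : ∀ a b, 0 ≤ r a b) (W : X → X → ℝ) :
    flowCost r W ≤ (∑ a, ∑ b, r a b) * flowSize W := by
  simp only [flowCost, flowSize, Finset.mul_sum (a := ∑ a, ∑ b, r a b)]
  refine Finset.sum_le_sum fun a _ => Finset.sum_le_sum fun b _ => ?_
  split_ifs
  · rw [mul_comm]
    exact mul_le_mul_of_nonneg_right (le_sum_sum hr a b) (abs_nonneg _)
  · simp

theorem minCost_le (h : IsFlow p m W) : minCost p m ≤ flowSize W :=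
  csInf_le ⟨0, by rintro _ ⟨V, -, rfl⟩; exact flowSize_nonneg V⟩ ⟨W, h, rfl⟩

theorem sDis_nonneg {r : X → X → ℝ} (hr : ∀ a b, 0 ≤ r a b) (p m : X → ℝ) :
    0 ≤ sDis r p m :=
  Real.sInf_nonneg (by rintro _ ⟨W, -, -, rfl⟩; exact flowCost_nonneg hr W)

theorem sDis_le {r : X → X → ℝ} (hr : ∀ a b, 0 ≤ r a b) (h : IsFlow p m W)
    (hW : flowSize W = minCost p m) : sDis r p m ≤ flowCost r W :=
  csInf_le ⟨0, by rintro _ ⟨V, -, -, rfl⟩; exact flowCost_nonneg hr V⟩ ⟨W, h, hW, rfl⟩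

theorem minCost_le_one (hp : p ∈ stdSimplex ℝ X) (hm : m ∈ stdSimplex ℝ X) :
    minCost p m ≤ 1 := by
  have h := isFlow_productFlow hp.2 hm.2
  refine (minCost_le h).trans ?_
  rw [h.flowSize_eq_half]
  have h1 : ∑ a, ∑ b, |productFlow p m a b| ≤ ∑ a, ∑ b, (p a * m b + p b * m a) := by
    refine Finset.sum_le_sum fun a _ => Finset.sum_le_sum fun b _ => ?_
    have h2 := mul_nonneg (hp.1 a) (hm.1 b)
    have h3 := mul_nonneg (hp.1 b) (hm.1 a)
    simp only [productFlow]
    rw [abs_le]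
    constructor <;> linarith
  simp only [Finset.sum_add_distrib, ← Finset.sum_mul, ← Finset.mul_sum, hp.2, hm.2] at h1
  linarith

theorem sDis_le_sum {r : X → X → ℝ} (hr : ∀ a b, 0 ≤ r a b)
    (hp : p ∈ stdSimplex ℝ X) (hm : m ∈ stdSimplex ℝ X) :
    sDis r p m ≤ ∑ a, ∑ b, r a b := by
  have hR : 0 ≤ ∑ a, ∑ b, r a b :=
    Finset.sum_nonneg fun a _ => Finset.sum_nonneg fun b _ => hr a b
  by_cases hW : ∃ W, IsFlow p m W ∧ flowSize W = minCost p m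
  · obtain ⟨W, hW, hs⟩ := hW
    refine (sDis_le hr hW hs).trans ((flowCost_le hr W).trans ?_)
    rw [hs]
    exact mul_le_of_le_one_right hR (minCost_le_one hp hm)
  · have : { t : ℝ | ∃ W : X → X → ℝ,
        IsFlow p m W ∧ flowSize W = minCost p m ∧ flowCost r W = t } = ∅ := by
      ext t
      simp only [Set.mem_ofPred_eq, Set.mem_empty_iff_false, iff_false]
      rintro ⟨W, h1, h2, -⟩
      exact hW ⟨W, h1, h2⟩
    rw [sDis, this, Real.sInf_empty]
    exact hR

theorem vertex_mem_stdSimplex (i : X) : vertex i ∈ stdSimplex ℝ X :=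
  ⟨fun j => by unfold vertex; split_ifs <;> norm_num, by simp [vertex]⟩

theorem sDis_self {r : X → X → ℝ} (hr : ∀ a b, 0 ≤ r a b) (p : X → ℝ) : sDis r p p = 0 := by
  have h0 : IsFlow p p 0 := ⟨by simp, by simp⟩
  have hs : flowSize (0 : X → X → ℝ) = 0 := by simp [flowSize]
  have hm : minCost p p = 0 := le_antisymm (hs ▸ minCost_le h0)
    (Real.sInf_nonneg (by rintro _ ⟨V, -, rfl⟩; exact flowSize_nonneg V))
  refine le_antisymm ((sDis_le hr h0 (hs.trans hm.symm)).trans ?_) (sDis_nonneg hr _ _)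
  simp [flowCost]

variable {i j : X}

theorem IsFlow.one_le_flowSize (hij : i ≠ j) (h : IsFlow (vertex i) (vertex j) W) :
    1 ≤ flowSize W := by
  have h1 := h.abs_sub_le_sum_row j
  have h2 := h.abs_sub_le_sum_col j
  simp only [vertex, hij.symm, if_true, if_false, sub_zero, abs_one] at h1 h2
  have key : ∑ a, ∑ b, ((if a = j then |W a b| else 0) + if b = j then |W a b| else 0) ≤
      ∑ a, ∑ b, |W a b| := by
    refine Finset.sum_le_sum fun a _ => Finset.sum_le_sum fun b _ => ?_
    have := abs_nonneg (W a b)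
    have := h.self_eq_zero j
    split_ifs <;> simp_all
  simp only [Finset.sum_add_distrib, Finset.sum_ite_irrel, Finset.sum_const_zero,
    Finset.sum_ite_eq', Finset.mem_univ, if_true] at key
  rw [h.flowSize_eq_half]
  linarith

theorem IsFlow.one_le_abs_of_flowSize_eq_one (hij : i ≠ j)
    (h : IsFlow (vertex i) (vertex j) W) (hs : flowSize W = 1) : 1 ≤ |W i j| := by
  have h1 := h.abs_sub_le_sum_row j
  have h2 := h.abs_sub_le_sum_col j
  have h3 := h.abs_sub_le_sum_row i
  have h4 := h.abs_sub_le_sum_col i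
  simp only [vertex, hij, hij.symm, if_true, if_false, sub_zero, zero_sub, abs_neg, abs_one]
    at h1 h2 h3 h4
  have key : ∑ a, ∑ b, ((if a = j then |W a b| else 0) + (if b = j then |W a b| else 0) +
      (if a = i then |W a b| else 0) + (if b = i then |W a b| else 0)) ≤
      ∑ a, ∑ b, (|W a b| + (if a = i then if b = j then |W a b| else 0 else 0) +
        (if a = j then if b = i then |W a b| else 0 else 0)) := by
    refine Finset.sum_le_sum fun a _ => Finset.sum_le_sum fun b _ => ?_
    have := abs_nonneg (W a b)
    have := h.self_eq_zero j
    have := h.self_eq_zero i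
    split_ifs <;> simp_all
  simp only [Finset.sum_add_distrib, Finset.sum_ite_irrel, Finset.sum_const_zero,
    Finset.sum_ite_eq', Finset.mem_univ, if_true] at key
  rw [h.flowSize_eq_half] at hs
  rw [h.abs_symm j i] at key
  linarith

theorem flowSize_productFlow_vertex_and_minCost_vertex (hij : i ≠ j) :
    flowSize (productFlow (vertex i) (vertex j)) = 1 ∧ minCost (vertex i) (vertex j) = 1 := by
  have h := isFlow_productFlow (vertex_mem_stdSimplex i).2 (vertex_mem_stdSimplex j).2
  have hs : flowSize (productFlow (vertex i) (vertex j)) = 1 := by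
    rw [h.flowSize_eq_half]
    simp only [abs_productFlow_vertex hij, Finset.sum_add_distrib, Finset.sum_ite_irrel,
      Finset.sum_const_zero, Finset.sum_ite_eq', Finset.mem_univ, if_true]
    norm_num
  refine ⟨hs, le_antisymm (hs ▸ minCost_le h) (le_csInf ⟨_, _, h, rfl⟩ ?_)⟩
  rintro _ ⟨V, hV, rfl⟩
  exact hV.one_le_flowSize hij

/-- The induced dissimilarity extends the original one. -/
theorem sDis_vertex {r : X → X → ℝ} (hr : ∀ a b, 0 ≤ r a b) (hsymm : ∀ a b, r a b = r b a)
    (hid : ∀ a, r a a = 0) (i j : X) : sDis r (vertex i) (vertex j) = r i j := by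
  rcases eq_or_ne i j with rfl | hij
  · rw [sDis_self hr, hid]
  have h := isFlow_productFlow (vertex_mem_stdSimplex i).2 (vertex_mem_stdSimplex j).2
  obtain ⟨hs, hm⟩ := flowSize_productFlow_vertex_and_minCost_vertex hij
  refine le_antisymm ((sDis_le hr h (hs.trans hm.symm)).trans_eq ?_)
    (le_csInf ⟨_, _, h, hs.trans hm.symm, rfl⟩ ?_)
  · rw [h.flowCost_eq_half hsymm]
    simp only [abs_productFlow_vertex hij, add_mul, ite_mul, one_mul, zero_mul,
      Finset.sum_add_distrib, Finset.sum_ite_irrel,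
      Finset.sum_const_zero, Finset.sum_ite_eq', Finset.mem_univ, if_true]
    rw [hsymm j i]
    ring
  · rintro _ ⟨V, hV, hVs, rfl⟩
    have h1 := hV.one_le_abs_of_flowSize_eq_one hij (hVs.trans hm)
    have h2 : |V i j| * r i j + |V j i| * r j i ≤ ∑ a, ∑ b, |V a b| * r a b := by
      have key : ∑ a, ∑ b, ((if a = i then if b = j then |V a b| * r a b else 0 else 0) +
          (if a = j then if b = i then |V a b| * r a b else 0 else 0)) ≤
          ∑ a, ∑ b, |V a b| * r a b := by
        refine Finset.sum_le_sum fun a _ => Finset.sum_le_sum fun b _ => ?_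
        have := mul_nonneg (abs_nonneg (V a b)) (hr a b)
        split_ifs <;> simp_all
      simpa only [Finset.sum_add_distrib, Finset.sum_ite_irrel, Finset.sum_const_zero,
        Finset.sum_ite_eq', Finset.mem_univ, if_true] using key
    rw [hV.flowCost_eq_half hsymm]
    rw [hV.abs_symm j i, hsymm j i] at h2
    have h3 := le_mul_of_one_le_left (hr i j) h1
    linarith

end Flow

theorem dPE_le_netDiff {X Y : Type*} (rX : X → X → ℝ) (rY : Y → Y → ℝ) (f : X → Y) :
    dPE rX rY ≤ netDiff rX rY f :=
  ciInf_le ⟨0, by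
    rintro _ ⟨g, rfl⟩
    exact Real.iSup_nonneg fun _ => Real.iSup_nonneg fun _ => abs_nonneg _⟩ f

/-- the partial embedding distance is bounded above by the
interior partial embedding distance. -/
theorem dPE_le_dPES
    {X Y : Type*} [Fintype X] [LinearOrder X] [Nonempty X]
    [Fintype Y] [LinearOrder Y] [Nonempty Y]
(rX : X → X → ℝ) (rY : Y → Y → ℝ)
    (hX0 : ∀ x x', 0 ≤ rX x x') (hXsymm : ∀ x x', rX x x' = rX x' x)
    (hXid : ∀ x x', rX x x' = 0 ↔ x = x')
    (hY0 : ∀ y y', 0 ≤ rY y y') (hYsymm : ∀ y y', rY y y' = rY y' y)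
    (hYid : ∀ y y', rY y y' = 0 ↔ y = y') :
    dPE rX rY ≤ dPES rX rY := by
  refine le_csInf ?_ ?_
  · obtain ⟨y₀⟩ := ‹Nonempty Y›
    exact ⟨_, fun _ => vertex y₀, fun _ _ => vertex_mem_stdSimplex y₀, fun _ => ⟨y₀, rfl⟩, rfl⟩
  rintro _ ⟨φ, hφ, hv, rfl⟩
  choose f hf using hv
  refine (dPE_le_netDiff rX rY f).trans (ciSup_le fun x => ciSup_le fun x' => ?_)
  refine le_csSup ⟨(∑ a, ∑ b, rX a b) + ∑ a, ∑ b, rY a b, ?_⟩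
    ⟨vertex x, vertex_mem_stdSimplex x, vertex x', vertex_mem_stdSimplex x', ?_⟩
  · rintro _ ⟨u, hu, u', hu', rfl⟩
    have h1 := sDis_nonneg hX0 u u'
    have h2 := sDis_le_sum hX0 hu hu'
    have h3 := sDis_nonneg hY0 (φ u) (φ u')
    have h4 := sDis_le_sum hY0 (hφ u hu) (hφ u' hu')
    rw [abs_le]
    constructor <;> linarith
  · rw [hf, hf, sDis_vertex hX0 hXsymm fun a => (hXid a a).2 rfl,
      sDis_vertex hY0 hYsymm fun a => (hYid a a).2 rfl]
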